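/- Let R be a commutative ring, A ∈ R^{m×n}, A° ∈ R^{n×m}, and let a_j denote the coefficient of Z^j in det(I_m + Z·(A·A°)). The following are equivalent: (1) the pair (A, A°) is crossed and D_k(A) = R, D_{k+1}(A) = 0; (2) a_h = 0 for all h > k, a_k is a unit of R, and the matrix θ := a_{k−1}·A° − a_{k−2}·A°·A·A° + ⋯ + (−1)^{k−1}·(A°·A)^{k−1}·A° satisfies the two equalities A·θ·A = a_k·A and A°·A·θ = a_k·A°. -/

import Mathlib

open Matrix Polynomial

/-- The `k`-th determinantal ideal of a matrix. -/
noncomputable def detIdeal {R : Type*} [CommRing R] {m n : ℕ} (k : ℕ)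
    (A : Matrix (Fin m) (Fin n) R) : Ideal R :=
  Ideal.span {x | ∃ (α : Fin k → Fin m) (β : Fin k → Fin n),
    StrictMono α ∧ StrictMono β ∧ x = (A.submatrix α β).det}

/-- `aCoeff A A' j` is the coefficient of `Z^j` in `det(I_m + Z·(A·A'))`. -/
noncomputable def aCoeff {R : Type*} [CommRing R] {m n : ℕ}
    (A : Matrix (Fin m) (Fin n) R) (A' : Matrix (Fin n) (Fin m) R) (j : ℕ) : R :=
  (((1 : Matrix (Fin m) (Fin m) R[X]) + (X : R[X]) • (A * A').map C).det).coeff j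

/-- `θ = a_{k−1}·A' − a_{k−2}·A'·A·A' + ⋯ + (−1)^{k−1}·(A'·A)^{k−1}·A'`. -/
noncomputable def adjK {R : Type*} [CommRing R] {m n : ℕ} (k : ℕ)
    (A : Matrix (Fin m) (Fin n) R) (A' : Matrix (Fin n) (Fin m) R) :
    Matrix (Fin n) (Fin m) R :=
  ∑ i ∈ Finset.range k, ((-1 : R) ^ i * aCoeff A A' (k - 1 - i)) • ((A' * A) ^ i * A')

/-- The pair `(A, A')` is crossed. -/
def Crossed {R : Type*} [CommRing R] {m n : ℕ}
    (A : Matrix (Fin m) (Fin n) R) (A' : Matrix (Fin n) (Fin m) R) : Prop :=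
  IsCompl (LinearMap.range A.mulVecLin) (LinearMap.ker A'.mulVecLin) ∧
    IsCompl (LinearMap.ker A.mulVecLin) (LinearMap.range A'.mulVecLin)


section Helpers

theorem map_smul_aux {R S : Type*} [CommRing R] [CommRing S] (f : R →+* S) {m n : ℕ}
    (c : R) (A : Matrix (Fin m) (Fin n) R) : (c • A).map f = f c • A.map f := by
  ext a b
  simp

theorem det_mul_sum {R : Type*} [CommRing R] {j p : ℕ}
    (U : Matrix (Fin j) (Fin p) R) (W : Matrix (Fin p) (Fin j) R) :
    (U * W).det = ∑ f : Fin j → Fin p, (∏ i, U i (f i)) * (W.submatrix f id).det := by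
  have h1 : (U * W).det = Matrix.detRowAlternating.toMultilinearMap
      (fun i => ∑ l : Fin p, U i l • W l) := by
    change (U * W).det = Matrix.det _
    congr 1
    ext i l
    simp [Matrix.mul_apply, Finset.sum_apply]
  rw [h1, MultilinearMap.map_sum]
  refine Finset.sum_congr rfl fun f _ => ?_
  rw [MultilinearMap.map_smul_univ]
  rfl

theorem minor_mem {R : Type*} [CommRing R] {m n j : ℕ} (A : Matrix (Fin m) (Fin n) R)
    (f : Fin j → Fin m) (g : Fin j → Fin n) : (A.submatrix f g).det ∈ detIdeal j A := by
  by_cases hf : Function.Injective f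
  swap
  · have : ∃ a b, f a = f b ∧ a ≠ b := by
      simpa [Function.Injective] using hf
    obtain ⟨a, b, hab, hne⟩ := this
    rw [Matrix.det_zero_of_row_eq hne (by ext l; simp [hab])]
    exact Ideal.zero_mem _
  by_cases hg : Function.Injective g
  swap
  · have : ∃ a b, g a = g b ∧ a ≠ b := by
      simpa [Function.Injective] using hg
    obtain ⟨a, b, hab, hne⟩ := this
    rw [Matrix.det_zero_of_column_eq hne (by intro l; simp [hab])]
    exact Ideal.zero_mem _
  have hsf : StrictMono (f ∘ Tuple.sort f) :=
    (Tuple.monotone_sort f).strictMono_of_injective (hf.comp (Tuple.sort f).injective)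
  have hsg : StrictMono (g ∘ Tuple.sort g) :=
    (Tuple.monotone_sort g).strictMono_of_injective (hg.comp (Tuple.sort g).injective)
  have key : (A.submatrix (f ∘ Tuple.sort f) (g ∘ Tuple.sort g)).det ∈ detIdeal j A :=
    Ideal.subset_span ⟨_, _, hsf, hsg, rfl⟩
  have e : A.submatrix f g = ((A.submatrix (f ∘ Tuple.sort f)
      (g ∘ Tuple.sort g)).submatrix (Tuple.sort f).symm id).submatrix id (Tuple.sort g).symm := by
    ext a b
    simp
  rw [e, Matrix.det_permute', Matrix.det_permute]
  exact Ideal.mul_mem_left _ _ (Ideal.mul_mem_left _ _ key)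

theorem det_mul_mul_mem {R : Type*} [CommRing R] {m n j : ℕ} (A : Matrix (Fin m) (Fin n) R)
    (U : Matrix (Fin j) (Fin m) R) (V : Matrix (Fin n) (Fin j) R) :
    (U * A * V).det ∈ detIdeal j A := by
  rw [Matrix.mul_assoc, det_mul_sum]
  refine Ideal.sum_mem _ fun f _ => Ideal.mul_mem_left _ _ ?_
  have e : ((A * V).submatrix f id) = (A.submatrix f id) * V := by
    ext a b; simp [Matrix.mul_apply]
  rw [e, ← Matrix.det_transpose, Matrix.transpose_mul, det_mul_sum]
  refine Ideal.sum_mem _ fun g _ => Ideal.mul_mem_left _ _ ?_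
  rw [← Matrix.det_transpose]
  exact minor_mem A f g

theorem detIdeal_eq_bot_of_factor {R : Type*} [CommRing R] {m n r j : ℕ} (h : r < j)
    (B : Matrix (Fin m) (Fin r) R) (D : Matrix (Fin r) (Fin n) R) :
    detIdeal j (B * D) = ⊥ := by
  rw [detIdeal, Ideal.span_eq_bot]
  rintro x ⟨α, β, -, -, rfl⟩
  have e : (B * D).submatrix α β = B.submatrix α id * D.submatrix id β := by
    ext a b; simp [Matrix.mul_apply]
  rw [e, det_mul_sum]
  refine Finset.sum_eq_zero fun f _ => ?_
  have : ¬ Function.Injective f := fun hf => by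
    have := Fintype.card_le_of_injective f hf
    simp at this; omega
  have : ∃ a b, f a = f b ∧ a ≠ b := by
    simpa [Function.Injective] using this
  obtain ⟨a, b, hab, hne⟩ := this
  rw [Matrix.det_zero_of_row_eq hne (by ext l; simp [hab]), mul_zero]

theorem detIdeal_map' {R S : Type*} [CommRing R] [CommRing S] (f : R →+* S) {m n : ℕ} (j : ℕ)
    (A : Matrix (Fin m) (Fin n) R) :
    detIdeal j (A.map f) = (detIdeal j A).map f := by
  rw [detIdeal, detIdeal, Ideal.map_span]
  congr 1
  ext x
  constructor
  · rintro ⟨α, β, hα, hβ, rfl⟩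
    refine ⟨_, ⟨α, β, hα, hβ, rfl⟩, ?_⟩
    rw [RingHom.map_det]; rfl
  · rintro ⟨_, ⟨α, β, hα, hβ, rfl⟩, rfl⟩
    refine ⟨α, β, hα, hβ, ?_⟩
    rw [RingHom.map_det]; rfl

theorem aCoeff_map {R S : Type*} [CommRing R] [CommRing S] (f : R →+* S) {m n : ℕ} (j : ℕ)
    (A : Matrix (Fin m) (Fin n) R) (A' : Matrix (Fin n) (Fin m) R) :
    aCoeff (A.map f) (A'.map f) j = f (aCoeff A A' j) := by
  rw [aCoeff, aCoeff, ← Polynomial.coeff_map, ← Polynomial.coe_mapRingHom, RingHom.map_det]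
  congr 2
  rw [← Matrix.map_mul]
  generalize A * A' = M
  ext a b : 2
  simp [Matrix.one_apply, apply_ite (Polynomial.map f)]

theorem adjK_map {R S : Type*} [CommRing R] [CommRing S] (f : R →+* S) {m n : ℕ} (k : ℕ)
    (A : Matrix (Fin m) (Fin n) R) (A' : Matrix (Fin n) (Fin m) R) :
    adjK k (A.map f) (A'.map f) = (adjK k A A').map f := by
  have e : (adjK k A A').map f = ∑ i ∈ Finset.range k,
      (((-1 : R) ^ i * aCoeff A A' (k - 1 - i)) • ((A' * A) ^ i * A')).map f := by
    ext a b
    simp [adjK, Matrix.sum_apply]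
  rw [e, adjK]
  refine Finset.sum_congr rfl fun i _ => ?_
  rw [aCoeff_map, map_smul_aux, Matrix.map_mul, Matrix.map_pow, Matrix.map_mul]
  simp

/-- Local splitting of an idempotent. -/
theorem exists_split {R : Type*} [CommRing R] [IsLocalRing R] {m : ℕ}
    (P : Matrix (Fin m) (Fin m) R) (hP : P * P = P) :
    ∃ (r : ℕ) (B : Matrix (Fin m) (Fin r) R) (C : Matrix (Fin r) (Fin m) R),
      C * B = 1 ∧ B * C = P := by
  let p : (Fin m → R) →ₗ[R] (Fin m → R) := P.mulVecLin
  let N := LinearMap.range p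
  have hpp : ∀ x, p (p x) = p x := fun x => by
    simp [p, Matrix.mulVec_mulVec, hP]
  have hpN : p.rangeRestrict ∘ₗ N.subtype = LinearMap.id := by
    ext ⟨x, y, rfl⟩ : 2
    exact hpp y
  have : Module.Projective R N := Module.Projective.of_split N.subtype p.rangeRestrict hpN
  have : Module.Finite R N := inferInstance
  have : Module.Free R N := Module.free_of_flat_of_isLocalRing
  let b := Module.finBasis R N
  let φ : N ≃ₗ[R] (Fin (Module.finrank R N) → R) := b.equivFun
  refine ⟨Module.finrank R N, LinearMap.toMatrix' (N.subtype ∘ₗ φ.symm.toLinearMap),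
    LinearMap.toMatrix' (φ.toLinearMap ∘ₗ p.rangeRestrict), ?_, ?_⟩
  · rw [← LinearMap.toMatrix'_comp, ← LinearMap.toMatrix'_id]
    congr 1
    rw [LinearMap.comp_assoc, ← LinearMap.comp_assoc _ N.subtype, hpN]
    ext; simp
  · rw [← LinearMap.toMatrix'_comp]
    have : (N.subtype ∘ₗ φ.symm.toLinearMap) ∘ₗ φ.toLinearMap ∘ₗ p.rangeRestrict = p := by
      apply LinearMap.ext; intro x; simp
    rw [this]
    exact LinearMap.toMatrix'_toLin' P

/-- Coefficients of `det (1 + X S)` for a square matrix. -/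
noncomputable def sqCoeff {R : Type*} [CommRing R] {r : ℕ} (S : Matrix (Fin r) (Fin r) R)
    (j : ℕ) : R :=
  (((1 : Matrix (Fin r) (Fin r) R[X]) + (X : R[X]) • S.map C).det).coeff j

theorem sqCoeff_eq {R : Type*} [CommRing R] [Nontrivial R] {r : ℕ}
    (S : Matrix (Fin r) (Fin r) R) (j : ℕ) :
    sqCoeff S j = (-S).charpoly.coeff (revAt r j) := by
  have h : ((1 : Matrix (Fin r) (Fin r) R[X]) + (X : R[X]) • S.map C).det = (-S).charpolyRev := by
    rw [Matrix.charpolyRev]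
    congr 1
    ext a b : 2
    simp
  rw [sqCoeff, h, ← Matrix.reverse_charpoly, Polynomial.coeff_reverse,
    Matrix.charpoly_natDegree_eq_dim, Fintype.card_fin]

theorem sqCoeff_gt {R : Type*} [CommRing R] [Nontrivial R] {r : ℕ}
    (S : Matrix (Fin r) (Fin r) R) (j : ℕ) (h : r < j) : sqCoeff S j = 0 := by
  rw [sqCoeff_eq, revAt_eq_self_of_lt h]
  apply Polynomial.coeff_eq_zero_of_natDegree_lt
  simpa using h

theorem sqCoeff_unit {R : Type*} [CommRing R] [Nontrivial R] {r : ℕ}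
    (S : Matrix (Fin r) (Fin r) R) (h : IsUnit S.det) : IsUnit (sqCoeff S r) := by
  have e := Matrix.det_eq_sign_charpoly_coeff (-S)
  rw [sqCoeff_eq, revAt_le le_rfl, Nat.sub_self]
  rw [Matrix.det_neg] at e
  have h2 : IsUnit ((-1 : R) ^ Fintype.card (Fin r) * S.det) :=
    ((isUnit_one.neg).pow _).mul h
  rw [e] at h2
  exact isUnit_of_mul_isUnit_right h2

theorem sqCoeff_CH {R : Type*} [CommRing R] [Nontrivial R] {r : ℕ}
    (S : Matrix (Fin r) (Fin r) R) :
    ∑ i ∈ Finset.range r, ((-1 : R) ^ i * sqCoeff S (r - 1 - i)) • S ^ (i + 1)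
      = sqCoeff S r • (1 : Matrix (Fin r) (Fin r) R) := by
  have h := Matrix.aeval_self_charpoly (-S)
  rw [Polynomial.aeval_eq_sum_range, Matrix.charpoly_natDegree_eq_dim, Fintype.card_fin,
    Finset.sum_range_succ'] at h
  rw [sqCoeff_eq S r, revAt_le le_rfl, Nat.sub_self]
  rw [pow_zero] at h
  rw [← sub_eq_zero, ← neg_eq_zero, neg_sub, sub_eq_add_neg, add_comm, ← Finset.sum_neg_distrib]
  rw [← h]
  congr 1
  refine Finset.sum_congr rfl fun i hi => ?_
  have hi := Finset.mem_range.1 hi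
  rw [sqCoeff_eq, revAt_le (by omega), show r - (r - 1 - i) = i + 1 by omega, neg_pow S (i+1),
    pow_succ (-1 : Matrix (Fin r) (Fin r) R) i]
  rcases neg_one_pow_eq_or R i with h1 | h1
  · have h2 : (-1 : Matrix (Fin r) (Fin r) R) ^ i = 1 := by
      have := congrArg (algebraMap R (Matrix (Fin r) (Fin r) R)) h1
      simpa using this
    rw [h1, h2]; simp
  · have h2 : (-1 : Matrix (Fin r) (Fin r) R) ^ i = -1 := by
      have := congrArg (algebraMap R (Matrix (Fin r) (Fin r) R)) h1
      simpa using this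
    rw [h1, h2]; simp

/-- Local structure. -/
theorem local_core {R : Type*} [CommRing R] [IsLocalRing R] {m n : ℕ}
    (A : Matrix (Fin m) (Fin n) R) (A' : Matrix (Fin n) (Fin m) R)
    (G : Matrix (Fin n) (Fin m) R) (Y : Matrix (Fin m) (Fin n) R)
    (h1 : A * G * A = A) (h2 : A' * A * G = A') (h3 : A * A' * Y = A) :
    ∃ r : ℕ, (∀ h, r < h → aCoeff A A' h = 0) ∧ IsUnit (aCoeff A A' r) ∧
      detIdeal r A = ⊤ ∧ (∀ j, r < j → detIdeal j A = ⊥) ∧ (∀ j, j ≤ r → detIdeal j A = ⊤) ∧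
      A * adjK r A A' * A = aCoeff A A' r • A ∧ A' * A * adjK r A A' = aCoeff A A' r • A' := by
  obtain ⟨r, B, C, hCB, hBC⟩ := exists_split (A * G) (by rw [← Matrix.mul_assoc, h1])
  have hA : B * (C * A) = A := by rw [← Matrix.mul_assoc, hBC, h1]
  have hA' : A' * B * C = A' := by rw [Matrix.mul_assoc, hBC, ← Matrix.mul_assoc, h2]
  obtain ⟨M, hM⟩ : ∃ M, M = A * A' := ⟨_, rfl⟩
  have hBM : B * C * M = M := by rw [hM, hBC, ← Matrix.mul_assoc, h1]
  have hMB : M * B * C = M := by rw [hM, Matrix.mul_assoc, Matrix.mul_assoc, ← Matrix.mul_assoc A', hA']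
  obtain ⟨S, hS⟩ : ∃ S, S = C * M * B := ⟨_, rfl⟩
  have hBS : M * B = B * S := by
    rw [hS, ← Matrix.mul_assoc, ← Matrix.mul_assoc, hBM]
  have hSC : C * M = S * C := by
    rw [hS, Matrix.mul_assoc, Matrix.mul_assoc, ← Matrix.mul_assoc M, hMB]
  have hdet : IsUnit S.det := by
    have : S * (C * (Y * G) * B) = 1 := by
      calc S * (C * (Y * G) * B) = (S * C) * (Y * G) * B := by simp only [Matrix.mul_assoc]
        _ = C * (A * A' * Y * G) * B := by rw [← hSC, hM]; simp only [Matrix.mul_assoc]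
        _ = (C * B) * (C * B) := by rw [h3, ← hBC]; simp only [Matrix.mul_assoc]
        _ = 1 := by rw [hCB, Matrix.mul_one]
    exact Matrix.isUnit_det_of_right_inverse this
  have haS : ∀ j, aCoeff A A' j = sqCoeff S j := by
    intro j
    rw [aCoeff, sqCoeff, ← hM]
    congr 1
    have e1 : (X : R[X]) • M.map Polynomial.C
        = B.map Polynomial.C * ((X : R[X]) • (C * M).map Polynomial.C) := by
      rw [Matrix.mul_smul, ← Matrix.map_mul, ← Matrix.mul_assoc, hBM]
    rw [e1, Matrix.det_one_add_mul_comm, Matrix.smul_mul, ← Matrix.map_mul, ← hS]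
  have hle : ∀ j, j ≤ r → detIdeal j A = ⊤ := by
    intro j hj
    rw [Ideal.eq_top_iff_one]
    have key := det_mul_mul_mem A (C.submatrix (Fin.castLE hj) id)
      ((G * B).submatrix id (Fin.castLE hj))
    have e : C.submatrix (Fin.castLE hj) id * A * (G * B).submatrix id (Fin.castLE hj) = 1 := by
      have e2 : C.submatrix (Fin.castLE hj) id * A * (G * B).submatrix id (Fin.castLE hj)
          = (C * A * (G * B)).submatrix (Fin.castLE hj) (Fin.castLE hj) := by
        ext a b; simp [Matrix.mul_apply]
      have e3 : C * A * (G * B) = 1 := by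
        calc C * A * (G * B) = C * (A * G) * B := by simp only [Matrix.mul_assoc]
          _ = (C * B) * (C * B) := by rw [← hBC]; simp only [Matrix.mul_assoc]
          _ = 1 := by rw [hCB, Matrix.mul_one]
      rw [e2, e3]
      exact Matrix.submatrix_one _ (Fin.castLE_injective hj)
    rwa [e, Matrix.det_one] at key
  have hpowB : ∀ i, M ^ i * B = B * S ^ i := by
    intro i
    induction i with
    | zero => simp
    | succ i ih => rw [pow_succ', Matrix.mul_assoc, ih, ← Matrix.mul_assoc, hBS, Matrix.mul_assoc, pow_succ']
  have hpowC : ∀ i, C * M ^ i = S ^ i * C := by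
    intro i
    induction i with
    | zero => simp
    | succ i ih => rw [pow_succ, ← Matrix.mul_assoc, ih, Matrix.mul_assoc, hSC, ← Matrix.mul_assoc, pow_succ]
  have hcomm : ∀ i, (A' * A) ^ i * A' = A' * M ^ i := by
    intro i
    induction i with
    | zero => simp
    | succ i ih => rw [pow_succ', Matrix.mul_assoc, ih, pow_succ', hM]; simp only [Matrix.mul_assoc]
  have hCH := sqCoeff_CH S
  have hth : adjK r A A' = ∑ i ∈ Finset.range r,
      ((-1 : R) ^ i * sqCoeff S (r - 1 - i)) • (A' * M ^ i) := by
    rw [adjK]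
    exact Finset.sum_congr rfl fun i _ => by rw [haS, hcomm]
  refine ⟨r, ?_, ?_, hle r le_rfl, ?_, hle, ?_, ?_⟩
  · intro h hh; rw [haS]; exact sqCoeff_gt S h hh
  · rw [haS]; exact sqCoeff_unit S hdet
  · intro j hj
    rw [← hA]; exact detIdeal_eq_bot_of_factor hj _ _
  · have : A * adjK r A A' * A = B * (∑ i ∈ Finset.range r,
        ((-1 : R) ^ i * sqCoeff S (r - 1 - i)) • S ^ (i + 1)) * (C * A) := by
      rw [hth, Matrix.mul_sum, Matrix.sum_mul, Matrix.mul_sum, Matrix.sum_mul]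
      refine Finset.sum_congr rfl fun i _ => ?_
      simp only [Matrix.mul_smul, Matrix.smul_mul]
      congr 1
      rw [← hpowB, Matrix.mul_assoc (M ^ (i+1)), hA, ← Matrix.mul_assoc, ← hM, ← pow_succ']
    rw [this, hCH, haS, Matrix.mul_smul, Matrix.mul_one, Matrix.smul_mul, hA]
  · have : A' * A * adjK r A A' = A' * B * (∑ i ∈ Finset.range r,
        ((-1 : R) ^ i * sqCoeff S (r - 1 - i)) • S ^ (i + 1)) * C := by
      rw [hth, Matrix.mul_sum, Matrix.mul_sum, Matrix.sum_mul]
      refine Finset.sum_congr rfl fun i _ => ?_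
      simp only [Matrix.mul_smul, Matrix.smul_mul]
      congr 1
      rw [Matrix.mul_assoc (A' * B), ← hpowC, ← Matrix.mul_assoc (A' * B), hA', pow_succ', hM]
      simp only [Matrix.mul_assoc]
    rw [this, hCH, haS, Matrix.mul_smul, Matrix.mul_one, Matrix.smul_mul, hA']

theorem exists_of_crossed {R : Type*} [CommRing R] {m n : ℕ}
    (A : Matrix (Fin m) (Fin n) R) (A' : Matrix (Fin n) (Fin m) R) (h : Crossed A A') :
    ∃ (G : Matrix (Fin n) (Fin m) R) (Y : Matrix (Fin m) (Fin n) R),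
      A * G * A = A ∧ A' * A * G = A' ∧ A * A' * Y = A := by
  obtain ⟨hc1, hc2⟩ := h
  have hG : ∀ y : Fin m → R, ∃ x : Fin n → R, A' *ᵥ (A *ᵥ x) = A' *ᵥ y := by
    intro y
    have : y ∈ LinearMap.range A.mulVecLin ⊔ LinearMap.ker A'.mulVecLin := by
      rw [hc1.sup_eq_top]; trivial
    obtain ⟨_, ⟨x, rfl⟩, z, hz, rfl⟩ := Submodule.mem_sup.1 this
    refine ⟨x, ?_⟩
    have hz : A' *ᵥ z = 0 := by simpa using hz
    simp [Matrix.mulVec_add, hz]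
  have hY : ∀ x : Fin n → R, ∃ y : Fin m → R, A *ᵥ (A' *ᵥ y) = A *ᵥ x := by
    intro x
    have : x ∈ LinearMap.ker A.mulVecLin ⊔ LinearMap.range A'.mulVecLin := by
      rw [hc2.sup_eq_top]; trivial
    obtain ⟨z, hz, _, ⟨y, rfl⟩, rfl⟩ := Submodule.mem_sup.1 this
    refine ⟨y, ?_⟩
    have hz : A *ᵥ z = 0 := by simpa using hz
    simp [Matrix.mulVec_add, hz]
  choose g hg using hG
  choose y hy using hY
  let G : Matrix (Fin n) (Fin m) R := Matrix.of fun i j => g (Pi.single j 1) i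
  let Y : Matrix (Fin m) (Fin n) R := Matrix.of fun i j => y (Pi.single j 1) i
  have hGe : ∀ j, G *ᵥ Pi.single j 1 = g (Pi.single j 1) := fun j => by
    ext i; simp [G]
  have hYe : ∀ j, Y *ᵥ Pi.single j 1 = y (Pi.single j 1) := fun j => by
    ext i; simp [Y]
  have e2 : A' * A * G = A' := by
    apply Matrix.ext_of_mulVec_single
    intro j
    rw [← Matrix.mulVec_mulVec, ← Matrix.mulVec_mulVec, hGe, hg]
  have e3 : A * A' * Y = A := by
    apply Matrix.ext_of_mulVec_single
    intro j
    rw [← Matrix.mulVec_mulVec, ← Matrix.mulVec_mulVec, hYe, hy]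
  refine ⟨G, Y, ?_, e2, e3⟩
  apply Matrix.ext_of_mulVec_single
  intro j
  rw [← sub_eq_zero]
  have hd := Submodule.disjoint_def.1 hc1.disjoint
  apply hd
  · refine ⟨(G * A) *ᵥ Pi.single j 1 - Pi.single j 1, ?_⟩
    rw [Matrix.mulVecLin_apply, Matrix.mulVec_sub, Matrix.mulVec_mulVec, Matrix.mul_assoc]
  · rw [LinearMap.mem_ker, Matrix.mulVecLin_apply, Matrix.mulVec_sub, Matrix.mulVec_mulVec,
      Matrix.mulVec_mulVec, ← Matrix.mul_assoc, ← Matrix.mul_assoc, e2, sub_self]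

theorem crossed_of {R : Type*} [CommRing R] {m n : ℕ}
    (A : Matrix (Fin m) (Fin n) R) (A' : Matrix (Fin n) (Fin m) R)
    (Q : Matrix (Fin m) (Fin m) R) (Q' : Matrix (Fin n) (Fin n) R)
    (hQ : A' * Q = Q' * A') (h1 : A * (A' * Q) * A = A)
    (h2 : A' * A * (A' * Q) = A') (h3 : A' * Q * A * A' = A') : Crossed A A' := by
  refine ⟨⟨?_, ?_⟩, ⟨?_, ?_⟩⟩
  · rw [Submodule.disjoint_def]
    rintro _ ⟨x, rfl⟩ hx
    have hx : A' *ᵥ (A *ᵥ x) = 0 := by simpa using hx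
    rw [Matrix.mulVecLin_apply]
    have : A *ᵥ x = (A * (Q' * A') * A) *ᵥ x := by rw [← hQ, h1]
    rw [this, ← Matrix.mulVec_mulVec, ← Matrix.mulVec_mulVec, ← Matrix.mulVec_mulVec, hx]
    simp
  · rw [codisjoint_iff, eq_top_iff]
    intro y _
    refine Submodule.mem_sup.2 ⟨A *ᵥ ((A' * Q) *ᵥ y), ⟨_, rfl⟩, y - A *ᵥ ((A' * Q) *ᵥ y), ?_, by simp⟩
    rw [LinearMap.mem_ker, Matrix.mulVecLin_apply, Matrix.mulVec_sub, Matrix.mulVec_mulVec,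
      Matrix.mulVec_mulVec, h2, sub_self]
  · rw [Submodule.disjoint_def]
    rintro _ hx ⟨y, rfl⟩
    have hx : A *ᵥ (A' *ᵥ y) = 0 := by simpa using hx
    rw [Matrix.mulVecLin_apply]
    have : A' *ᵥ y = (A' * Q * A * A') *ᵥ y := by rw [h3]
    rw [this, ← Matrix.mulVec_mulVec, ← Matrix.mulVec_mulVec, hx]
    simp
  · rw [codisjoint_iff, eq_top_iff]
    intro x _
    refine Submodule.mem_sup.2 ⟨x - A' *ᵥ ((Q * A) *ᵥ x), ?_, A' *ᵥ ((Q * A) *ᵥ x), ⟨_, rfl⟩, by simp⟩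
    rw [LinearMap.mem_ker, Matrix.mulVecLin_apply, Matrix.mulVec_sub, Matrix.mulVec_mulVec,
      Matrix.mulVec_mulVec, Matrix.mul_assoc A, ← Matrix.mul_assoc A', ← Matrix.mul_assoc A, h1, sub_self]

theorem matrix_eq_of_local {R : Type*} [CommRing R] {m n : ℕ} (U V : Matrix (Fin m) (Fin n) R)
    (h : ∀ (J : Ideal R) (_ : J.IsMaximal),
      U.map (algebraMap R (Localization.AtPrime J)) = V.map (algebraMap R (Localization.AtPrime J))) :
    U = V := by
  ext a b
  rw [← sub_eq_zero]
  apply eq_zero_of_localization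
  intro J hJ
  have := congrFun (congrFun (h J hJ) a) b
  simpa [sub_eq_zero] using this

end Helpers

theorem stmt17 {R : Type*} [CommRing R] {m n k : ℕ}
    (A : Matrix (Fin m) (Fin n) R) (A' : Matrix (Fin n) (Fin m) R) :
    (Crossed A A' ∧ detIdeal k A = ⊤ ∧ detIdeal (k + 1) A = ⊥) ↔
      ((∀ h, k < h → aCoeff A A' h = 0) ∧ IsUnit (aCoeff A A' k) ∧
        A * adjK k A A' * A = aCoeff A A' k • A ∧
        A' * A * adjK k A A' = aCoeff A A' k • A') := by
  constructor
  · rintro ⟨hc, hk, hk1⟩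
    obtain ⟨G, Y, h1, h2, h3⟩ := exists_of_crossed A A' hc
    have loc : ∀ (J : Ideal R) (_ : J.IsMaximal),
        (∀ h, k < h → algebraMap R (Localization.AtPrime J) (aCoeff A A' h) = 0) ∧
        IsUnit (algebraMap R (Localization.AtPrime J) (aCoeff A A' k)) ∧
        (A * adjK k A A' * A).map (algebraMap R (Localization.AtPrime J)) =
          (aCoeff A A' k • A).map (algebraMap R (Localization.AtPrime J)) ∧
        (A' * A * adjK k A A').map (algebraMap R (Localization.AtPrime J)) =
          (aCoeff A A' k • A').map (algebraMap R (Localization.AtPrime J)) := by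
      intro J hJ
      obtain ⟨f, hf⟩ : ∃ f, f = algebraMap R (Localization.AtPrime J) := ⟨_, rfl⟩
      rw [← hf]
      obtain ⟨r, c1, c2, -, c4, c5, c6, c7⟩ := local_core (A.map f) (A'.map f) (G.map f) (Y.map f)
        (by rw [← Matrix.map_mul, ← Matrix.map_mul, h1])
        (by rw [← Matrix.map_mul, ← Matrix.map_mul, h2])
        (by rw [← Matrix.map_mul, ← Matrix.map_mul, h3])
      have d1 : detIdeal k (A.map f) = ⊤ := by rw [detIdeal_map', hk, Ideal.map_top]
      have d2 : detIdeal (k + 1) (A.map f) = ⊥ := by rw [detIdeal_map', hk1, Ideal.map_bot]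
      have hr : r = k := by
        apply le_antisymm
        · by_contra hlt
          have := c5 (k + 1) (by omega)
          rw [d2] at this
          exact bot_ne_top this
        · by_contra hlt
          have := c4 k (by omega)
          rw [d1] at this
          exact bot_ne_top this.symm
      subst hr
      refine ⟨fun h hh => by rw [← aCoeff_map, c1 h hh], by rwa [← aCoeff_map], ?_, ?_⟩
      · rw [Matrix.map_mul, Matrix.map_mul, ← adjK_map, c6, map_smul_aux, aCoeff_map]
      · rw [Matrix.map_mul, Matrix.map_mul, ← adjK_map, c7, map_smul_aux, aCoeff_map]
    refine ⟨fun h hh => eq_zero_of_localization _ fun J hJ => (loc J hJ).1 h hh, ?_,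
      matrix_eq_of_local _ _ fun J hJ => (loc J hJ).2.2.1,
      matrix_eq_of_local _ _ fun J hJ => (loc J hJ).2.2.2⟩
    rw [← Ideal.span_singleton_eq_top]
    apply Ideal.eq_of_localization_maximal
    intro J hJ
    rw [Ideal.map_span, Ideal.map_top, Set.image_singleton, Ideal.span_singleton_eq_top]
    exact (loc J hJ).2.1
  · rintro ⟨hz, hu, e1, e2⟩
    obtain ⟨u, hu'⟩ := hu
    obtain ⟨v, hv⟩ : ∃ v : R, v * aCoeff A A' k = 1 := ⟨↑u⁻¹, by rw [← hu']; simp⟩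
    have hcomm : ∀ i, (A' * A) ^ i * A' = A' * (A * A') ^ i := by
      intro i
      induction i with
      | zero => simp
      | succ i ih => rw [pow_succ', Matrix.mul_assoc, ih, pow_succ']; simp only [Matrix.mul_assoc]
    obtain ⟨Q, hQd⟩ : ∃ Q, Q = v • ∑ i ∈ Finset.range k,
      ((-1 : R) ^ i * aCoeff A A' (k - 1 - i)) • (A * A') ^ i := ⟨_, rfl⟩
    obtain ⟨Q', hQd'⟩ : ∃ Q', Q' = v • ∑ i ∈ Finset.range k,
      ((-1 : R) ^ i * aCoeff A A' (k - 1 - i)) • (A' * A) ^ i := ⟨_, rfl⟩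
    have hQ : A' * Q = v • adjK k A A' := by
      rw [hQd, adjK, Matrix.mul_smul, Matrix.mul_sum]
      congr 1
      exact Finset.sum_congr rfl fun i _ => by rw [Matrix.mul_smul, hcomm]
    have hQ' : Q' * A' = v • adjK k A A' := by
      rw [hQd', adjK, Matrix.smul_mul, Matrix.sum_mul]
      congr 1
      exact Finset.sum_congr rfl fun i _ => by rw [Matrix.smul_mul]
    have hQc : Q * (A * A') = (A * A') * Q := by
      rw [hQd, Matrix.mul_smul, Matrix.smul_mul, Matrix.mul_sum, Matrix.sum_mul]
      congr 1
      exact Finset.sum_congr rfl fun i _ => by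
        rw [Matrix.mul_smul, Matrix.smul_mul, ← pow_succ, ← pow_succ']
    have h1 : A * (A' * Q) * A = A := by
      rw [hQ, Matrix.mul_smul, Matrix.smul_mul, e1, smul_smul, hv, one_smul]
    have h2 : A' * A * (A' * Q) = A' := by
      rw [hQ, Matrix.mul_smul, e2, smul_smul, hv, one_smul]
    have h3 : A' * Q * A * A' = A' := by
      rw [Matrix.mul_assoc, Matrix.mul_assoc, hQc]
      simpa only [Matrix.mul_assoc] using h2
    have h4 : A * A' * (Q * A) = A := by
      simpa only [Matrix.mul_assoc] using h1
    have loc : ∀ (J : Ideal R) (_ : J.IsMaximal),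
        (detIdeal k A).map (algebraMap R (Localization.AtPrime J)) = ⊤ ∧
        (detIdeal (k + 1) A).map (algebraMap R (Localization.AtPrime J)) = ⊥ := by
      intro J hJ
      obtain ⟨f, hf⟩ : ∃ f, f = algebraMap R (Localization.AtPrime J) := ⟨_, rfl⟩
      rw [← hf]
      obtain ⟨r, c1, c2, c3, c4, -⟩ := local_core (A.map f) (A'.map f)
        ((A' * Q).map f) ((Q * A).map f)
        (by rw [← Matrix.map_mul, ← Matrix.map_mul, h1])
        (by rw [← Matrix.map_mul, ← Matrix.map_mul, h2])
        (by rw [← Matrix.map_mul, ← Matrix.map_mul, h4])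
      have d1 : ∀ h, k < h → aCoeff (A.map f) (A'.map f) h = 0 := fun h hh => by
        rw [aCoeff_map, hz h hh, map_zero]
      have d2 : IsUnit (aCoeff (A.map f) (A'.map f) k) := by
        rw [aCoeff_map, ← hu']; exact u.isUnit.map f
      have hr : r = k := by
        apply le_antisymm
        · by_contra hlt
          rw [d1 r (by omega)] at c2
          exact not_isUnit_zero c2
        · by_contra hlt
          rw [c1 k (by omega)] at d2
          exact not_isUnit_zero d2
      subst hr
      rw [← detIdeal_map', ← detIdeal_map']
      exact ⟨c3, c4 _ (Nat.lt_succ_self _)⟩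
    refine ⟨crossed_of A A' Q Q' (hQ.trans hQ'.symm) h1 h2 h3, ?_, ?_⟩
    · apply Ideal.eq_of_localization_maximal
      intro J hJ
      rw [Ideal.map_top, (loc J hJ).1]
    · apply Ideal.eq_of_localization_maximal
      intro J hJ
      rw [Ideal.map_bot, (loc J hJ).2]
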